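/- Let c ∈ ℝ^{N×M} and suppose that for k = 1,…,K we have distinct pairs of marginals (μ^(k),ν^(k)) ∈ Δ_N × Δ_M, plans π^(k) ∈ OPT_c(μ^(k),ν^(k)) with α^(k) = ⟨c,π^(k)⟩, and extreme points u^(1,k),…,u^(L_k,k) ∈ EP(μ^(k),ν^(k)) representing π^(k) such that the convex hull of {u^(ℓ,k) : ℓ ∈ {1,…,L_k}} equals OPT_c(μ^(k),ν^(k)) for every k. If the family {u^(ℓ,k) : ℓ, k}, viewed as vectors in ℝ^{NM}, contains fewer than NM linearly independent elements, then c is not identifiable: there exists c' ∈ ℝ^{N×M} with c' ≠ c and ⟨c',π^(k)⟩ = OT_{c'}(μ^(k),ν^(k)) = α^(k) for all k. -/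

import Mathlib

open Finset

noncomputable section

/-- Frobenius inner product of two `N × M` real matrices. -/
def frob {N M : ℕ} (c π : Matrix (Fin N) (Fin M) ℝ) : ℝ := ∑ i, ∑ j, c i j * π i j

/-- The set `Π(μ,ν)` of transport plans between `μ` and `ν`. -/
def Plans {N M : ℕ} (μ : Fin N → ℝ) (ν : Fin M → ℝ) : Set (Matrix (Fin N) (Fin M) ℝ) :=
  {π | (∀ i j, 0 ≤ π i j) ∧ (∀ i, ∑ j, π i j = μ i) ∧ (∀ j, ∑ i, π i j = ν j)}

/-- The optimal transport cost `OT_c(μ,ν)`. -/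
def OTcost {N M : ℕ} (c : Matrix (Fin N) (Fin M) ℝ) (μ : Fin N → ℝ) (ν : Fin M → ℝ) : ℝ :=
  sInf (frob c '' Plans μ ν)

/-- The set `OPT_c(μ,ν)` of optimal transport plans. -/
def OPT {N M : ℕ} (c : Matrix (Fin N) (Fin M) ℝ) (μ : Fin N → ℝ) (ν : Fin M → ℝ) :
    Set (Matrix (Fin N) (Fin M) ℝ) :=
  {π ∈ Plans μ ν | frob c π = OTcost c μ ν}

/-- The set `EP(μ,ν)` of extreme points of the transport polytope. -/
def EP {N M : ℕ} (μ : Fin N → ℝ) (ν : Fin M → ℝ) : Set (Matrix (Fin N) (Fin M) ℝ) :=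
  Set.extremePoints ℝ (Plans μ ν)

open Filter Topology

/-- The Frobenius pairing with a fixed matrix, as a linear functional. -/
def frobLinear {N M : ℕ} (c : Matrix (Fin N) (Fin M) ℝ) : Matrix (Fin N) (Fin M) ℝ →ₗ[ℝ] ℝ where
  toFun := frob c
  map_add' x y := by simp [frob, mul_add, Finset.sum_add_distrib]
  map_smul' r x := by simp [frob, Finset.mul_sum, mul_left_comm]

theorem frob_add_smul_left {N M : ℕ} (c d x : Matrix (Fin N) (Fin M) ℝ) (t : ℝ) :
    frob (c + t • d) x = frob c x + t * frob d x := by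
  simp [frob, add_mul, Finset.sum_add_distrib, Finset.mul_sum, mul_assoc]

theorem continuous_frob {N M : ℕ} (c : Matrix (Fin N) (Fin M) ℝ) : Continuous (frob c) := by
  unfold frob
  fun_prop

/-- Every linear functional on matrices is a Frobenius pairing. -/
theorem exists_frob_eq {N M : ℕ} (f : Matrix (Fin N) (Fin M) ℝ →ₗ[ℝ] ℝ) :
    ∃ d : Matrix (Fin N) (Fin M) ℝ, ∀ x, frob d x = f x := by
  refine ⟨Matrix.of fun i j => f (Matrix.single i j 1), fun x => ?_⟩
  conv_rhs => rw [Matrix.matrix_eq_sum_single x]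
  simp only [map_sum, frob, Matrix.of_apply]
  refine Finset.sum_congr rfl fun i _ => Finset.sum_congr rfl fun j _ => ?_
  rw [show Matrix.single i j (x i j) = x i j • Matrix.single i j (1 : ℝ) by
    simp [Matrix.smul_single], map_smul, smul_eq_mul, mul_comm]

theorem exists_ne_zero_frob_eq_zero {N M : ℕ} (S : Set (Matrix (Fin N) (Fin M) ℝ))
    (hS : Module.finrank ℝ (Submodule.span ℝ S) < N * M) :
    ∃ d : Matrix (Fin N) (Fin M) ℝ, d ≠ 0 ∧ ∀ x ∈ S, frob d x = 0 := by
  have hlt : Submodule.span ℝ S < ⊤ := by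
    rw [lt_top_iff_ne_top]
    intro h
    rw [h, finrank_top, Module.finrank_matrix] at hS
    simp at hS
  obtain ⟨f, hf, hle⟩ := Submodule.exists_le_ker_of_lt_top _ hlt
  obtain ⟨d, hd⟩ := exists_frob_eq f
  refine ⟨d, ?_, fun x hx => ?_⟩
  · rintro rfl
    exact hf (LinearMap.ext fun x => by simp [← hd, frob])
  · rw [hd]
    exact hle (Submodule.subset_span hx)

theorem convex_Plans {N M : ℕ} (μ : Fin N → ℝ) (ν : Fin M → ℝ) : Convex ℝ (Plans μ ν) := by
  rintro x ⟨hx, hxr, hxc⟩ y ⟨hy, hyr, hyc⟩ a b ha hb hab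
  refine ⟨fun i j => ?_, fun i => ?_, fun j => ?_⟩
  · have := hx i j
    have := hy i j
    simp only [Matrix.add_apply, Matrix.smul_apply, smul_eq_mul]
    positivity
  · simp only [Matrix.add_apply, Matrix.smul_apply, smul_eq_mul, Finset.sum_add_distrib,
      ← Finset.mul_sum, hxr, hyr, ← add_mul, hab, one_mul]
  · simp only [Matrix.add_apply, Matrix.smul_apply, smul_eq_mul, Finset.sum_add_distrib,
      ← Finset.mul_sum, hxc, hyc, ← add_mul, hab, one_mul]

theorem isCompact_Plans {N M : ℕ} (μ : Fin N → ℝ) (ν : Fin M → ℝ) : IsCompact (Plans μ ν) := by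
  have hbox : IsCompact (Set.univ.pi fun i : Fin N => Set.univ.pi fun _ : Fin M =>
      Set.Icc (0 : ℝ) (μ i)) :=
    isCompact_univ_pi fun i => isCompact_univ_pi fun _ => isCompact_Icc
  refine IsCompact.of_isClosed_subset (X := Fin N → Fin M → ℝ) hbox ?_ ?_
  · have h : Plans μ ν = (⋂ i, ⋂ j, {x : Matrix (Fin N) (Fin M) ℝ | 0 ≤ x i j}) ∩
        ((⋂ i, {x | ∑ j, x i j = μ i}) ∩ ⋂ j, {x | ∑ i, x i j = ν j}) := by
      ext x
      simp [Plans]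
    rw [h]
    refine IsClosed.inter ?_ (IsClosed.inter ?_ ?_)
    · exact isClosed_iInter fun i => isClosed_iInter fun j =>
        isClosed_le continuous_const (by fun_prop)
    · exact isClosed_iInter fun i => isClosed_eq (by fun_prop) continuous_const
    · exact isClosed_iInter fun j => isClosed_eq (by fun_prop) continuous_const
  · rintro x ⟨hx, hxr, -⟩ i - j -
    exact ⟨hx i j, hxr i ▸ Finset.single_le_sum (fun j _ => hx i j) (Finset.mem_univ j)⟩

/-- An extreme point of the transport polytope is the only plan supported on its support. -/
theorem eq_of_mem_EP_of_support_subset {N M : ℕ} {μ : Fin N → ℝ} {ν : Fin M → ℝ}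
    {x y : Matrix (Fin N) (Fin M) ℝ} (hx : x ∈ EP μ ν) (hy : y ∈ Plans μ ν)
    (h : ∀ i j, x i j = 0 → y i j = 0) : x = y := by
  obtain ⟨⟨hx0, hxr, hxc⟩, hext⟩ := hx
  have hpos : ∀ᶠ t : ℝ in 𝓝[>] 0, ∀ i j, 0 ≤ x i j + t * (x i j - y i j) := by
    refine eventually_all.2 fun i => eventually_all.2 fun j => ?_
    rcases (hx0 i j).eq_or_lt with h0 | h0
    · simp [← h0, h i j h0.symm]
    · have ht : Tendsto (fun t : ℝ => x i j + t * (x i j - y i j)) (𝓝[>] 0) (𝓝 (x i j)) := by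
        refine Tendsto.mono_left ?_ nhdsWithin_le_nhds
        exact Continuous.tendsto' (by fun_prop) _ _ (by simp)
      exact (ht.eventually (lt_mem_nhds h0)).mono fun _ => le_of_lt
  obtain ⟨t, ht, ht0⟩ := (hpos.and self_mem_nhdsWithin).exists
  have ht0 : 0 < t := ht0
  have hz : x + t • (x - y) ∈ Plans μ ν := by
    refine ⟨fun i j => by simpa using ht i j, fun i => ?_, fun j => ?_⟩
    · simp [Finset.sum_add_distrib, ← Finset.mul_sum, hxr, hy.2.1]
    · simp [Finset.sum_add_distrib, ← Finset.mul_sum, hxc, hy.2.2]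
  refine (hext hy hz ⟨t / (1 + t), 1 / (1 + t), by positivity, by positivity, by field_simp; ring,
    ?_⟩).symm
  ext i j
  simp only [Matrix.add_apply, Matrix.smul_apply, Matrix.sub_apply, smul_eq_mul]
  field_simp
  ring

theorem finite_EP {N M : ℕ} (μ : Fin N → ℝ) (ν : Fin M → ℝ) : (EP μ ν).Finite := by
  refine Set.Finite.of_injOn (f := fun x => {p : Fin N × Fin M | x p.1 p.2 = 0})
    (Set.mapsTo_univ _ _) ?_ Set.finite_univ
  intro x hx y hy hxy
  exact eq_of_mem_EP_of_support_subset hx hy.1 fun i j h => (Set.ext_iff.1 hxy (i, j)).1 h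

/-- A lower bound for the cost on the extreme points is a lower bound on the polytope. -/
theorem le_frob_of_forall_EP {N M : ℕ} {μ : Fin N → ℝ} {ν : Fin M → ℝ}
    {c : Matrix (Fin N) (Fin M) ℝ} {a : ℝ} (h : ∀ x ∈ EP μ ν, a ≤ frob c x)
    {x : Matrix (Fin N) (Fin M) ℝ} (hx : x ∈ Plans μ ν) : a ≤ frob c x := by
  have hkm := closure_convexHull_extremePoints (E := Fin N → Fin M → ℝ)
    (isCompact_Plans μ ν) (convex_Plans μ ν)
  have hsub : closure (convexHull ℝ (EP μ ν)) ⊆ {x | a ≤ frob c x} :=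
    closure_minimal (convexHull_min h (convex_halfSpace_ge (frobLinear c).isLinear a))
      (isClosed_le continuous_const (continuous_frob c))
  exact hsub (hkm.symm.subset hx)

theorem OTcost_le_frob {N M : ℕ} {μ : Fin N → ℝ} {ν : Fin M → ℝ}
    (c : Matrix (Fin N) (Fin M) ℝ) {x : Matrix (Fin N) (Fin M) ℝ} (hx : x ∈ Plans μ ν) :
    OTcost c μ ν ≤ frob c x :=
  csInf_le ((isCompact_Plans μ ν).image (continuous_frob c)).bddBelow (Set.mem_image_of_mem _ hx)

/-- If `d` vanishes on the optimal plans, then small perturbations of `c` along `d` do not lower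
the optimal cost. -/
theorem eventually_OTcost_le_frob_add_smul {N M : ℕ} {μ : Fin N → ℝ} {ν : Fin M → ℝ}
    {c d : Matrix (Fin N) (Fin M) ℝ} (hd : ∀ x ∈ OPT c μ ν, frob d x = 0) :
    ∀ᶠ t : ℝ in 𝓝[>] 0, ∀ x ∈ Plans μ ν, OTcost c μ ν ≤ frob (c + t • d) x := by
  have hEP : ∀ᶠ t : ℝ in 𝓝[>] 0, ∀ x ∈ EP μ ν, OTcost c μ ν ≤ frob (c + t • d) x := by
    refine (finite_EP μ ν).eventually_all.2 fun x hx => ?_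
    simp only [frob_add_smul_left]
    rcases (OTcost_le_frob c hx.1).eq_or_lt with h | h
    · simp [hd x ⟨hx.1, h.symm⟩, h]
    · have ht : Tendsto (fun t : ℝ => frob c x + t * frob d x) (𝓝[>] 0) (𝓝 (frob c x)) := by
        refine Tendsto.mono_left ?_ nhdsWithin_le_nhds
        exact Continuous.tendsto' (by fun_prop) _ _ (by simp)
      exact (ht.eventually (lt_mem_nhds h)).mono fun _ => le_of_lt
  exact hEP.mono fun t ht x hx => le_frob_of_forall_EP ht hx

/-- Converse: if the representing extreme points exhaust the optimal faces but span fewer than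
`NM` dimensions, then the cost matrix is not identifiable from total costs and OT plans. -/
theorem stmt12 (N M K : ℕ) (hN : 1 ≤ N) (hM : 1 ≤ M)
    (μ : Fin K → Fin N → ℝ) (ν : Fin K → Fin M → ℝ)
    (hμ : ∀ k, μ k ∈ stdSimplex ℝ (Fin N)) (hν : ∀ k, ν k ∈ stdSimplex ℝ (Fin M))
    (hdist : Function.Injective (fun k => (μ k, ν k)))
    (c : Matrix (Fin N) (Fin M) ℝ)
    (π : Fin K → Matrix (Fin N) (Fin M) ℝ) (hπ : ∀ k, π k ∈ OPT c (μ k) (ν k))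
    (α : Fin K → ℝ) (hα : ∀ k, α k = frob c (π k))
    (L : Fin K → ℕ) (u : (k : Fin K) → Fin (L k) → Matrix (Fin N) (Fin M) ℝ)
    (hu : ∀ k ℓ, u k ℓ ∈ EP (μ k) (ν k))
    (hrep : ∀ k, ∃ lam : Fin (L k) → ℝ,
      (∀ ℓ, 0 < lam ℓ) ∧ (∑ ℓ, lam ℓ = 1) ∧ π k = ∑ ℓ, lam ℓ • u k ℓ)
    (hconv : ∀ k, convexHull ℝ (Set.range (u k)) = OPT c (μ k) (ν k))
    (hspan : Module.finrank ℝ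
        (Submodule.span ℝ {x : Matrix (Fin N) (Fin M) ℝ | ∃ k ℓ, x = u k ℓ}) < N * M) :
    ∃ c' : Matrix (Fin N) (Fin M) ℝ, c' ≠ c ∧
      ∀ k, frob c' (π k) = α k ∧ OTcost c' (μ k) (ν k) = α k := by
  obtain ⟨d, hd0, hd⟩ := exists_ne_zero_frob_eq_zero _ hspan
  have hdOPT : ∀ k, ∀ x ∈ OPT c (μ k) (ν k), frob d x = 0 := by
    intro k x hx
    rw [← hconv k] at hx
    refine convexHull_min (t := {x | frob d x = 0}) ?_
      (convex_hyperplane (frobLinear d).isLinear 0) hx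
    rintro _ ⟨ℓ, rfl⟩
    exact hd _ ⟨k, ℓ, rfl⟩
  obtain ⟨t, ht, ht0⟩ := ((eventually_all.2 fun k =>
    eventually_OTcost_le_frob_add_smul (hdOPT k)).and self_mem_nhdsWithin).exists
  have ht0 : 0 < t := ht0
  refine ⟨c + t • d, by simp [ht0.ne', hd0], fun k => ?_⟩
  have hcost : frob (c + t • d) (π k) = α k := by
    rw [frob_add_smul_left, hdOPT k _ (hπ k), mul_zero, add_zero, hα]
  refine ⟨hcost, IsLeast.csInf_eq ⟨⟨π k, (hπ k).1, hcost⟩, ?_⟩⟩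
  rintro _ ⟨x, hx, rfl⟩
  rw [hα, (hπ k).2]
  exact ht k x hx
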